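/- arXiv:2105.08023 — 3 statements merged into one kernel-verified Lean document; each statement's English description precedes it below -/
import Mathlib

section
/- Proposition 1 (magnitude of the optimal dual variable). Let W ∈ ℝ^{n×n} be symmetric and doubly stochastic with λ₂(W) < 1, set W̄ := (I+W)/2, V := (I−W̄)^{1/2}, and λ̄₂ := (1+λ₂(W))/2 ∈ (0,1). Let each fᵢ: ℝ^d → ℝ be convex and differentiable, let x* be a global minimizer of f := (1/n)∑ᵢ fᵢ, X* := 𝟙ₙ(x*)ᵀ, and let γ > 0. If Y* ∈ ℝ^{n×d} has all columns in the column space of V and satisfies γ W̄ ∇f(X*) + V Y* = 0, then ‖Y*‖_F² ≤ γ² λ̄₂² ‖∇f(X*)‖_F² / (1 − λ̄₂), where ∇f(X*) is the matrix with i-th row ∇fᵢ(x*)ᵀ and ‖·‖_F is the Frobenius norm. -/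
open Matrix

/-- The squared Frobenius norm as a trace. -/
lemma sum_sq_eq_trace_transpose_mul_self {m n : Type*} [Fintype m] [Fintype n]
    (M : Matrix m n ℝ) : ∑ i, ∑ j, M i j ^ 2 = (Mᵀ * M).trace := by
  simp only [trace, diag_apply, mul_apply, transpose_apply]
  rw [Finset.sum_comm]
  simp only [sq]

lemma trace_transpose_mul_diagonal_mul {m n : Type*} [Fintype m] [Fintype n] [DecidableEq m]
    (c : m → ℝ) (M : Matrix m n ℝ) :
    (Mᵀ * (diagonal c * M)).trace = ∑ i, ∑ j, c i * M i j ^ 2 := by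
  simp only [trace, diag_apply, Matrix.mul_apply (M := Mᵀ), transpose_apply, diagonal_mul]
  rw [Finset.sum_comm]
  exact Finset.sum_congr rfl fun i _ => Finset.sum_congr rfl fun j _ => by ring

/-- The quadratic form of `I + W` is nonnegative when `W` is doubly stochastic. -/
lemma dotProduct_self_add_dotProduct_mulVec_nonneg {m : Type*} [Fintype m]
    (W : Matrix m m ℝ) (hnn : ∀ i j, 0 ≤ W i j)
    (hrow : ∀ i, ∑ j, W i j = 1) (hcol : ∀ j, ∑ i, W i j = 1) (v : m → ℝ) :
    0 ≤ v ⬝ᵥ v + v ⬝ᵥ (W *ᵥ v) := by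
  have h : 0 ≤ ∑ i, ∑ j, W i j * (v i + v j) ^ 2 :=
    Finset.sum_nonneg fun i _ => Finset.sum_nonneg fun j _ =>
      mul_nonneg (hnn i j) (sq_nonneg _)
  have h₁ : ∑ i, ∑ j, W i j * v i ^ 2 = v ⬝ᵥ v := by
    simp only [← Finset.sum_mul, hrow, dotProduct, one_mul, sq]
  have h₂ : ∑ i, ∑ j, W i j * v j ^ 2 = v ⬝ᵥ v := by
    rw [Finset.sum_comm]
    simp only [← Finset.sum_mul, hcol, dotProduct, one_mul, sq]
  have h₃ : ∑ i, ∑ j, v i * (W i j * v j) = v ⬝ᵥ (W *ᵥ v) := by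
    simp only [dotProduct, mulVec, Finset.mul_sum]
  have h₄ : ∑ i, ∑ j, W i j * (v i + v j) ^ 2
      = ∑ i, ∑ j, W i j * v i ^ 2 + ∑ i, ∑ j, W i j * v j ^ 2
        + 2 * ∑ i, ∑ j, v i * (W i j * v j) := by
    simp only [Finset.mul_sum, ← Finset.sum_add_distrib]
    exact Finset.sum_congr rfl fun i _ => Finset.sum_congr rfl fun j _ => by ring
  rw [h₄, h₁, h₂, h₃] at h
  linarith

/-- The eigenvalues of a doubly stochastic matrix are at least `-1`. -/
lemma neg_one_le_of_mulVec_eq_smul {m : Type*} [Fintype m]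
    (W : Matrix m m ℝ) (hnn : ∀ i j, 0 ≤ W i j)
    (hrow : ∀ i, ∑ j, W i j = 1) (hcol : ∀ j, ∑ i, W i j = 1)
    {v : m → ℝ} (hv : v ≠ 0) {μ : ℝ} (hμ : W *ᵥ v = μ • v) : -1 ≤ μ := by
  have h := dotProduct_self_add_dotProduct_mulVec_nonneg W hnn hrow hcol v
  rw [hμ, dotProduct_smul, smul_eq_mul] at h
  have hpos : 0 < v ⬝ᵥ v :=
    lt_of_le_of_ne (Finset.sum_nonneg fun i _ => mul_self_nonneg _)
      (Ne.symm (mt dotProduct_self_eq_zero.mp hv))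
  nlinarith

/-- An eigenvalue of an orthogonally diagonalized matrix occurs on the diagonal. -/
lemma exists_eq_of_mulVec_eq_smul {m : Type*} [Fintype m] [DecidableEq m]
    {U : Matrix m m ℝ} (hU : Uᵀ * U = 1) {c : m → ℝ} {v : m → ℝ} (hv : v ≠ 0) {μ : ℝ}
    (hμ : (U * diagonal c * Uᵀ) *ᵥ v = μ • v) : ∃ k, c k = μ := by
  have hU' : U * Uᵀ = 1 := mul_eq_one_comm.mp hU
  have hw : Uᵀ *ᵥ v ≠ 0 := fun h => hv <| by
    rw [← one_mulVec v, ← hU', ← mulVec_mulVec, h, mulVec_zero]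
  obtain ⟨k, hk⟩ := Function.ne_iff.mp hw
  refine ⟨k, mul_right_cancel₀ hk ?_⟩
  have h := congrArg (Uᵀ *ᵥ ·) hμ
  simp only [mulVec_mulVec, mulVec_smul, ← Matrix.mul_assoc, hU, Matrix.one_mul] at h
  rw [← mulVec_mulVec] at h
  simpa [mulVec_diagonal] using congrFun h k

lemma mul_sq_le_of_mul_eq {γ μ l z g : ℝ} (hμ : 0 ≤ μ) (hμl : μ ≤ l) (hl : l < 1)
    (h : (1 - μ) * z = -(γ * (μ * g))) :
    (1 - μ) * z ^ 2 ≤ γ ^ 2 * l ^ 2 * g ^ 2 / (1 - l) := by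
  have hpos : 0 < 1 - l := by linarith
  rw [le_div_iff₀ hpos]
  calc (1 - μ) * z ^ 2 * (1 - l) ≤ (1 - μ) * z ^ 2 * (1 - μ) := by
        have : 0 ≤ 1 - μ := by linarith
        gcongr
    _ = ((1 - μ) * z) ^ 2 := by ring
    _ = γ ^ 2 * μ ^ 2 * g ^ 2 := by rw [h]; ring
    _ ≤ γ ^ 2 * l ^ 2 * g ^ 2 := by gcongr

/-- Proposition 1 (magnitude of the optimal dual variable): with `W` symmetric
doubly stochastic having sorted eigenvalues `lam` (via an orthogonal
eigendecomposition) with `λ₂(W) < 1`, `W̄ = (I+W)/2`, `λ̄₂ = (1+λ₂(W))/2`, `V`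
the PSD square root of `I − W̄`, and `x*` a global minimizer of the average of
convex differentiable `fᵢ`: any `Y*` with columns in the column space of `V`
satisfying `γW̄∇f(X*) + VY* = 0` obeys
`‖Y*‖_F² ≤ γ²λ̄₂²‖∇f(X*)‖_F²/(1 − λ̄₂)`. -/
theorem optimal_dual_magnitude (n d : ℕ) (hn : 2 ≤ n)
    (W : Matrix (Fin n) (Fin n) ℝ) (hWsym : W.IsSymm) (hWnn : ∀ i j, 0 ≤ W i j)
    (hWrow : W *ᵥ (fun _ => (1 : ℝ)) = fun _ => 1)
    (hWcol : Matrix.vecMul (fun _ => (1 : ℝ)) W = fun _ => 1)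
    (U : Matrix (Fin n) (Fin n) ℝ) (hU : Uᵀ * U = 1)
    (lam : Fin n → ℝ) (hlam : ∀ i j : Fin n, i ≤ j → lam j ≤ lam i)
    (hWd : W = U * Matrix.diagonal lam * Uᵀ)
    (hlam2 : lam ⟨1, by omega⟩ < 1)
    (V : Matrix (Fin n) (Fin n) ℝ) (hV : V.PosSemidef)
    (hVsq : V * V = 1 - (2 : ℝ)⁻¹ • (1 + W))
    (f : Fin n → EuclideanSpace ℝ (Fin d) → ℝ)
    (hconv : ∀ i, ConvexOn ℝ Set.univ (f i))
    (hdiff : ∀ i, Differentiable ℝ (f i))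
    (xstar : EuclideanSpace ℝ (Fin d))
    (hmin : ∀ y, (n : ℝ)⁻¹ * ∑ i, f i xstar ≤ (n : ℝ)⁻¹ * ∑ i, f i y)
    (γ : ℝ) (hγ : 0 < γ)
    (Ystar : Matrix (Fin n) (Fin d) ℝ)
    (hYrange : ∃ Z : Matrix (Fin n) (Fin d) ℝ, Ystar = V * Z)
    (hYopt : γ • (((2 : ℝ)⁻¹ • (1 + W)) * Matrix.of (fun i j => gradient (f i) xstar j))
      + V * Ystar = 0) :
    ∑ i, ∑ j, (Ystar i j) ^ 2 ≤
      γ ^ 2 * ((1 + lam ⟨1, by omega⟩) / 2) ^ 2 *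
        (∑ i, ∑ j, (gradient (f i) xstar j) ^ 2) / (1 - (1 + lam ⟨1, by omega⟩) / 2) := by
  obtain ⟨Z, rfl⟩ := hYrange
  set G : Matrix (Fin n) (Fin d) ℝ := Matrix.of fun i j => gradient (f i) xstar j
  set i₁ : Fin n := ⟨1, by omega⟩
  have hU' : U * Uᵀ = 1 := mul_eq_one_comm.mp hU
  have hrow : ∀ i, ∑ j, W i j = 1 := fun i => by
    simpa [mulVec, dotProduct] using congrFun hWrow i
  have hcol : ∀ j, ∑ i, W i j = 1 := fun j => by
    simpa [vecMul, dotProduct] using congrFun hWcol j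
  have hlam_ge : ∀ k, -1 ≤ lam k := fun k => by
    refine neg_one_le_of_mulVec_eq_smul W hWnn hrow hcol (v := U *ᵥ Pi.single k 1) ?_ ?_
    · intro h
      have h' := congrArg (Uᵀ *ᵥ ·) h
      simp only [mulVec_mulVec, hU, one_mulVec, mulVec_zero] at h'
      simpa using congrFun h' k
    · rw [hWd, mulVec_mulVec, Matrix.mul_assoc, hU, Matrix.mul_one, ← mulVec_mulVec,
        diagonal_mulVec_single, mul_one, ← mulVec_smul, ← Pi.single_smul, smul_eq_mul, mul_one]
  obtain ⟨k₀, hk₀⟩ : ∃ k, lam k = 1 := by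
    refine exists_eq_of_mulVec_eq_smul hU (v := fun _ => 1) ?_ (by rw [← hWd, hWrow, one_smul])
    exact fun h => one_ne_zero (congrFun h ⟨0, by omega⟩)
  have hlam_le : ∀ k, lam k = 1 ∨ lam k ≤ lam i₁ := fun k => by
    rcases le_or_gt i₁ k with hk | hk
    · exact Or.inr (hlam _ _ hk)
    · have hk₀' : k₀ < i₁ := by
        by_contra! hle
        linarith [hlam _ _ hle]
      have hkk : k = k₀ := by
        ext
        have h₁ : (k : ℕ) < 1 := hk
        have h₂ : (k₀ : ℕ) < 1 := hk₀'
        omega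
      exact Or.inl (hkk ▸ hk₀)
  set μ : Fin n → ℝ := fun k => (1 + lam k) / 2 with hμ
  have hWbar : (2 : ℝ)⁻¹ • (1 + W) = U * diagonal μ * Uᵀ := by
    have hd : diagonal μ = (2 : ℝ)⁻¹ • (1 + diagonal lam) := by
      rw [← diagonal_one, diagonal_add, ← diagonal_smul]
      congr 1
      ext k
      simp [hμ]
      ring
    rw [hd, hWd, Matrix.mul_smul, Matrix.smul_mul, Matrix.mul_add, Matrix.add_mul,
      Matrix.mul_one, hU']
  have hVV : V * V = U * diagonal (fun k => 1 - μ k) * Uᵀ := by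
    have hd : diagonal (fun k => 1 - μ k) = 1 - diagonal μ := by
      rw [← diagonal_one, diagonal_sub]
    rw [hVsq, hWbar, hd, Matrix.mul_sub, Matrix.sub_mul, Matrix.mul_one, hU']
  have hVt : Vᵀ = V := by simpa using hV.isHermitian.eq
  have hY : ∑ i, ∑ j, (V * Z) i j ^ 2 = ∑ k, ∑ j, (1 - μ k) * (Uᵀ * Z) k j ^ 2 := by
    rw [sum_sq_eq_trace_transpose_mul_self, ← trace_transpose_mul_diagonal_mul,
      transpose_mul, hVt, Matrix.mul_assoc, ← Matrix.mul_assoc V, hVV]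
    simp only [transpose_mul, transpose_transpose, Matrix.mul_assoc]
  have hGsum : ∑ i, ∑ j, gradient (f i) xstar j ^ 2 = ∑ k, ∑ j, (Uᵀ * G) k j ^ 2 := by
    change ∑ i, ∑ j, G i j ^ 2 = _
    rw [sum_sq_eq_trace_transpose_mul_self, sum_sq_eq_trace_transpose_mul_self, transpose_mul,
      transpose_transpose, Matrix.mul_assoc, ← Matrix.mul_assoc U, hU', Matrix.one_mul]
  have hcoord : ∀ k j, (1 - μ k) * (Uᵀ * Z) k j = -(γ * (μ k * (Uᵀ * G) k j)) := fun k j => by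
    rw [hWbar, ← Matrix.mul_assoc V, hVV] at hYopt
    have h := congrArg (Uᵀ * ·) hYopt
    simp only [Matrix.mul_add, Matrix.mul_smul, ← Matrix.mul_assoc, hU, Matrix.one_mul,
      Matrix.mul_zero] at h
    simp only [Matrix.mul_assoc] at h
    have h' := congrFun (congrFun h k) j
    simp only [Matrix.add_apply, Matrix.smul_apply, diagonal_mul, Matrix.zero_apply,
      smul_eq_mul] at h'
    linarith
  change _ ≤ γ ^ 2 * μ i₁ ^ 2 * _ / (1 - μ i₁)
  have hl : μ i₁ < 1 := by
    simp only [hμ]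
    linarith
  rw [hY, hGsum]
  simp only [Finset.mul_sum, Finset.sum_div]
  refine Finset.sum_le_sum fun k _ => Finset.sum_le_sum fun j _ => ?_
  rcases hlam_le k with hk | hk
  · have hk' : μ k = 1 := by
      simp only [hμ]
      linarith
    rw [hk', sub_self, zero_mul]
    have : 0 < 1 - μ i₁ := by linarith
    positivity
  · refine mul_sq_le_of_mul_eq ?_ ?_ hl (hcoord k j)
    · simp only [hμ]
      linarith [hlam_ge k]
    · simp only [hμ]
      linarith
end

section
/- Equivalence of the primal and primal-dual forms of D²/Exact-Diffusion. Let W ∈ ℝ^{n×n} be symmetric and doubly stochastic, W̄ := (I+W)/2, V := (I−W̄)^{1/2}, and γ ∈ ℝ. Let (G^{(k)})_{k≥0} be any sequence in ℝ^{n×d}, and define sequences (X^{(k)}), (Y^{(k)}) in ℝ^{n×d} by: Y^{(0)} = 0, X^{(k+1)} = W̄(X^{(k)} − γ G^{(k)}) − V Y^{(k)} and Y^{(k+1)} = Y^{(k)} + V X^{(k+1)} for all k ≥ 0. Then X^{(1)} = W̄(X^{(0)} − γ G^{(0)}) and, for every k ≥ 1, X^{(k+1)} = W̄( 2X^{(k)}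 − X^{(k−1)} − γ(G^{(k)} − G^{(k−1)}) ). -/
open Matrix

/-- Equivalence of the primal and primal-dual forms of D²/Exact-Diffusion:
if `Y⁰ = 0`, `X^{k+1} = W̄(X^k − γG^k) − VY^k` and `Y^{k+1} = Y^k + VX^{k+1}`,
where `W̄ = (I+W)/2` and `V` is the positive semidefinite square root of
`I − W̄`, then `X¹ = W̄(X⁰ − γG⁰)` and
`X^{k+1} = W̄(2X^k − X^{k−1} − γ(G^k − G^{k−1}))` for all `k ≥ 1`. -/
theorem primal_dual_equivalence (n d : ℕ)
    (W : Matrix (Fin n) (Fin n) ℝ) (hWsym : W.IsSymm) (hWnn : ∀ i j, 0 ≤ W i j)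
    (hWrow : W *ᵥ (fun _ => (1 : ℝ)) = fun _ => 1)
    (hWcol : Matrix.vecMul (fun _ => (1 : ℝ)) W = fun _ => 1)
    (γ : ℝ)
    (V : Matrix (Fin n) (Fin n) ℝ) (hV : V.PosSemidef)
    (hVsq : V * V = 1 - (2 : ℝ)⁻¹ • (1 + W))
    (G X Y : ℕ → Matrix (Fin n) (Fin d) ℝ)
    (hY0 : Y 0 = 0)
    (hX : ∀ k, X (k + 1) = ((2 : ℝ)⁻¹ • (1 + W)) * (X k - γ • G k) - V * Y k)
    (hY : ∀ k, Y (k + 1) = Y k + V * X (k + 1)) :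
    X 1 = ((2 : ℝ)⁻¹ • (1 + W)) * (X 0 - γ • G 0) ∧
    ∀ k, 1 ≤ k →
      X (k + 1) = ((2 : ℝ)⁻¹ • (1 + W)) *
        (2 • X k - X (k - 1) - γ • (G k - G (k - 1))) := by
  refine ⟨by simpa [hY0] using hX 0, fun k hk => ?_⟩
  obtain ⟨k, rfl⟩ := Nat.exists_eq_add_of_le' hk
  rw [Nat.add_sub_cancel, hX (k + 1), hY k, Matrix.mul_add, ← Matrix.mul_assoc, hVsq]
  have hVY : V * Y k = ((2 : ℝ)⁻¹ • (1 + W)) * (X k - γ • G k) - X (k + 1) := by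
    rw [hX k]
    abel
  rw [hVY]
  generalize (2 : ℝ)⁻¹ • (1 + W) = M
  simp only [Matrix.sub_mul, Matrix.mul_sub, Matrix.one_mul, smul_sub, two_smul, Matrix.mul_add]
  abel
end

section
/- Let each fᵢ: ℝ^d → ℝ (i = 1,…,n) be convex and L-smooth, let f := (1/n)∑ᵢ fᵢ, and let x* be a global minimizer of f. Then for any points x₁,…,xₙ ∈ ℝ^d with x̄ := (1/n)∑ᵢ xᵢ, ‖ (1/n) ∑_{i=1}^n ( ∇fᵢ(xᵢ) − ∇fᵢ(x*) ) ‖² ≤ (2L²/n) ∑_{i=1}^n ‖ xᵢ − x̄ ‖² + 4L ( f(x̄) − f(x*) ). -/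
section SmoothConvex

open scoped RealInnerProductSpace

variable {E : Type*} [NormedAddCommGroup E] [InnerProductSpace ℝ E]

lemma norm_inv_smul_sum_sq_le {n : ℕ} (w : Fin n → E) :
    ‖(n : ℝ)⁻¹ • ∑ i, w i‖ ^ 2 ≤ (n : ℝ)⁻¹ * ∑ i, ‖w i‖ ^ 2 := by
  rcases n.eq_zero_or_pos with rfl | hn
  · simp
  have hn' : (0 : ℝ) < n := by exact_mod_cast hn
  have h : ‖∑ i, w i‖ ^ 2 ≤ n * ∑ i, ‖w i‖ ^ 2 := by
    calc ‖∑ i, w i‖ ^ 2 ≤ (∑ i, ‖w i‖) ^ 2 := by gcongr; exact norm_sum_le _ _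
      _ ≤ n * ∑ i, ‖w i‖ ^ 2 := by
        simpa using sq_sum_le_card_mul_sum_sq (s := Finset.univ) (f := fun i => ‖w i‖)
  rw [norm_smul, mul_pow, Real.norm_of_nonneg (inv_nonneg.2 hn'.le)]
  calc (n : ℝ)⁻¹ ^ 2 * ‖∑ i, w i‖ ^ 2 ≤ (n : ℝ)⁻¹ ^ 2 * (n * ∑ i, ‖w i‖ ^ 2) := by gcongr
    _ = _ := by field_simp

variable [CompleteSpace E]

lemma HasGradientAt.hasDerivAt_line {g : E → ℝ} {g' x v : E} {t : ℝ}
    (h : HasGradientAt g g' (x + t • v)) :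
    HasDerivAt (fun s : ℝ => g (x + s • v)) ⟪g', v⟫ t := by
  have hl : HasDerivAt (fun s : ℝ => x + s • v) v t := by
    simpa using ((hasDerivAt_id t).smul_const v).const_add x
  simpa [Function.comp_def] using h.hasFDerivAt.comp_hasDerivAt t hl

/-- A differentiable convex function lies above its tangent hyperplanes. -/
lemma ConvexOn.add_inner_gradient_le {g : E → ℝ} (hg : ConvexOn ℝ Set.univ g) {x : E}
    (hd : DifferentiableAt ℝ g x) (y : E) :
    g x + ⟪gradient g x, y - x⟫ ≤ g y := by
  have hline : ConvexOn ℝ Set.univ (fun t : ℝ => g (x + t • (y - x))) := by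
    simpa [Function.comp_def, AffineMap.lineMap_apply, add_comm] using
      hg.comp_affineMap (AffineMap.lineMap x y : ℝ →ᵃ[ℝ] E)
  have hder : HasDerivAt (fun t : ℝ => g (x + t • (y - x))) ⟪gradient g x, y - x⟫ 0 :=
    HasGradientAt.hasDerivAt_line (by simpa using hd.hasGradientAt)
  have := hline.le_slope_of_hasDerivAt (Set.mem_univ 0) (Set.mem_univ 1) one_pos hder
  simp only [slope_def_field, one_smul, zero_smul, add_zero, add_sub_cancel, sub_zero,
    div_one] at this
  linarith

/-- The descent lemma for functions with Lipschitz gradient. -/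
lemma le_add_inner_gradient_add_sq {g : E → ℝ} {L : ℝ} (hd : Differentiable ℝ g)
    (hlip : ∀ x y, ‖gradient g x - gradient g y‖ ≤ L * ‖x - y‖) (x y : E) :
    g y ≤ g x + ⟪gradient g x, y - x⟫ + L / 2 * ‖y - x‖ ^ 2 := by
  set v := y - x with hv
  have hder (t : ℝ) : HasDerivAt
      (fun t : ℝ => g (x + t • v) - t * ⟪gradient g x, v⟫ - t ^ 2 * (L / 2 * ‖v‖ ^ 2))
      (⟪gradient g (x + t • v), v⟫ - ⟪gradient g x, v⟫ - t * (L * ‖v‖ ^ 2)) t := by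
    refine ((((hd (x + t • v)).hasGradientAt.hasDerivAt_line).fun_sub
      ((hasDerivAt_id t).mul_const ⟪gradient g x, v⟫)).fun_sub
      ((hasDerivAt_pow 2 t).mul_const (L / 2 * ‖v‖ ^ 2))).congr_deriv ?_
    simp only [Nat.cast_ofNat, Nat.add_one_sub_one, pow_one, one_mul]
    ring
  have hanti : AntitoneOn
      (fun t : ℝ => g (x + t • v) - t * ⟪gradient g x, v⟫ - t ^ 2 * (L / 2 * ‖v‖ ^ 2))
      (Set.Ici 0) := by
    refine antitoneOn_of_hasDerivWithinAt_nonpos (convex_Ici 0)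
      (fun t _ => (hder t).continuousAt.continuousWithinAt)
      (fun t _ => (hder t).hasDerivWithinAt) fun t ht => ?_
    have ht0 : 0 < t := by simpa using ht
    have h := hlip (x + t • v) x
    rw [add_sub_cancel_left, norm_smul, Real.norm_of_nonneg ht0.le] at h
    have hcs := real_inner_le_norm (gradient g (x + t • v) - gradient g x) v
    rw [inner_sub_left] at hcs
    nlinarith [mul_le_mul_of_nonneg_right h (norm_nonneg v)]
  have h := hanti (Set.mem_Ici.2 le_rfl) (Set.mem_Ici.2 zero_le_one) zero_le_one
  simp only [one_smul, zero_smul, add_zero, hv, add_sub_cancel, one_pow, one_mul, zero_mul,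
    sub_zero, ne_eq, OfNat.ofNat_ne_zero, not_false_eq_true, zero_pow] at h
  linarith

/-- The gradient difference of a smooth convex function is controlled by its Bregman divergence. -/
lemma ConvexOn.norm_gradient_sub_sq_le {g : E → ℝ} {L : ℝ} (hL : 0 < L)
    (hg : ConvexOn ℝ Set.univ g) (hd : Differentiable ℝ g)
    (hlip : ∀ x y, ‖gradient g x - gradient g y‖ ≤ L * ‖x - y‖) (x y : E) :
    ‖gradient g x - gradient g y‖ ^ 2 ≤ 2 * L * (g x - g y - ⟪gradient g y, x - y⟫) := by
  set u := gradient g x - gradient g y with hu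
  have hlow := hg.add_inner_gradient_le (hd y) (x - L⁻¹ • u)
  have hup := le_add_inner_gradient_add_sq hd hlip x (x - L⁻¹ • u)
  have huu : ⟪gradient g x, u⟫ - ⟪gradient g y, u⟫ = ‖u‖ ^ 2 := by
    rw [← inner_sub_left, ← hu, real_inner_self_eq_norm_sq]
  rw [sub_right_comm, inner_sub_right, real_inner_smul_right] at hlow
  rw [sub_sub_cancel_left, inner_neg_right, real_inner_smul_right, norm_neg, norm_smul,
    Real.norm_of_nonneg (inv_nonneg.2 hL.le)] at hup
  have hsq : L / 2 * (L⁻¹ * ‖u‖) ^ 2 = L⁻¹ * ‖u‖ ^ 2 / 2 := by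
    field_simp
  have key : L⁻¹ * ‖u‖ ^ 2 / 2 ≤ g x - g y - ⟪gradient g y, x - y⟫ := by
    have := congrArg (L⁻¹ * ·) huu
    simp only [mul_sub] at this
    linarith
  calc ‖u‖ ^ 2 = 2 * L * (L⁻¹ * ‖u‖ ^ 2 / 2) := by field_simp
    _ ≤ _ := by gcongr

lemma sum_gradient_eq_zero_of_isLocalMin {ι : Type*} [Fintype ι] {f : ι → E → ℝ} {x : E}
    (hd : ∀ i, DifferentiableAt ℝ (f i) x) (hmin : IsLocalMin (fun y => ∑ i, f i y) x) :
    ∑ i, gradient (f i) x = 0 := by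
  have h := hmin.hasFDerivAt_eq_zero
    (HasFDerivAt.fun_sum fun i (_ : i ∈ Finset.univ) => (hd i).hasGradientAt.hasFDerivAt)
  rw [← map_sum] at h
  exact (map_eq_zero_iff _ (InnerProductSpace.toDual ℝ E).injective).1 h

end SmoothConvex


/-- Gradient-difference bound: for convex `L`-smooth `fᵢ` with `x*` a global
minimizer of the average `f`, and any points `x₁,…,xₙ` with average `x̄`,
`‖(1/n)∑ᵢ(∇fᵢ(xᵢ) − ∇fᵢ(x*))‖² ≤ (2L²/n)∑ᵢ‖xᵢ − x̄‖² + 4L(f(x̄) − f(x*))`. -/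
theorem gradient_difference_bound (n d : ℕ) (hn : 0 < n) (L : ℝ) (hL : 0 < L)
    (f : Fin n → EuclideanSpace ℝ (Fin d) → ℝ)
    (hconv : ∀ i, ConvexOn ℝ Set.univ (f i))
    (hdiff : ∀ i, Differentiable ℝ (f i))
    (hlip : ∀ i x y, ‖gradient (f i) x - gradient (f i) y‖ ≤ L * ‖x - y‖)
    (xstar : EuclideanSpace ℝ (Fin d))
    (hmin : ∀ y, (n : ℝ)⁻¹ * ∑ i, f i xstar ≤ (n : ℝ)⁻¹ * ∑ i, f i y)
    (x : Fin n → EuclideanSpace ℝ (Fin d)) :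
    let xb : EuclideanSpace ℝ (Fin d) := (n : ℝ)⁻¹ • ∑ j, x j
    ‖(n : ℝ)⁻¹ • ∑ i, (gradient (f i) (x i) - gradient (f i) xstar)‖ ^ 2 ≤
      (2 * L ^ 2 / (n : ℝ)) * ∑ i, ‖x i - xb‖ ^ 2
        + 4 * L * ((n : ℝ)⁻¹ * ∑ i, f i xb - (n : ℝ)⁻¹ * ∑ i, f i xstar) := by
  intro xb
  have hn' : (0 : ℝ) < n := by exact_mod_cast hn
  have hzero : ∑ i, gradient (f i) xstar = 0 :=
    sum_gradient_eq_zero_of_isLocalMin (fun i => hdiff i xstar) <|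
      Filter.Eventually.of_forall fun y => le_of_mul_le_mul_left (hmin y) (inv_pos.2 hn')
  have hterm (i : Fin n) : ‖gradient (f i) (x i) - gradient (f i) xstar‖ ^ 2 ≤
      2 * L ^ 2 * ‖x i - xb‖ ^ 2 + 4 * L *
        (f i xb - f i xstar - inner ℝ (gradient (f i) xstar) (xb - xstar)) := by
    have ha : ‖gradient (f i) (x i) - gradient (f i) xb‖ ^ 2 ≤ (L * ‖x i - xb‖) ^ 2 := by
      gcongr
      exact hlip i _ _
    have hb := (hconv i).norm_gradient_sub_sq_le hL (hdiff i) (hlip i) xb xstar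
    have htri := norm_sub_le_norm_sub_add_norm_sub (gradient (f i) (x i)) (gradient (f i) xb)
      (gradient (f i) xstar)
    have hsq := pow_le_pow_left₀ (norm_nonneg _) htri 2
    have := hsq.trans add_sq_le
    linarith
  calc _ ≤ (n : ℝ)⁻¹ * ∑ i, ‖gradient (f i) (x i) - gradient (f i) xstar‖ ^ 2 :=
        norm_inv_smul_sum_sq_le _
    _ ≤ (n : ℝ)⁻¹ * ∑ i, (2 * L ^ 2 * ‖x i - xb‖ ^ 2 + 4 * L *
        (f i xb - f i xstar - inner ℝ (gradient (f i) xstar) (xb - xstar))) := by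
      gcongr with i
      exact hterm i
    _ = _ := by
      rw [Finset.sum_add_distrib, ← Finset.mul_sum, ← Finset.mul_sum, Finset.sum_sub_distrib,
        Finset.sum_sub_distrib, ← sum_inner, hzero, inner_zero_left]
      ring
end
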